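/- Assume: Ω : ℝ × ℝ → ℝ is a C¹ function of (t,ξ) with partial derivative Ω_ξ in the second argument; s ∈ {−1,1}; φ : ℝ³ → ℝ is a C² function of (x,t,κ) satisfying the eikonal equation ∂_tφ(x,t,κ) = s·Ω(t, κ − ∂_xφ(x,t,κ)) for all (x,t,κ). Fix κ ∈ ℝ and let x : ℝ → ℝ be differentiable and satisfy ∂_κφ(x(t),t,κ) = x(t) for all t, with ∂_x∂_κφ(x(t),t,κ) ≠ 1 for all t. Then for all t: x'(t) = s·Ω_ξ(t, κ − ∂_xφ(x(t),t,κ)). -/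

import Mathlib

/-- The derivative of a function along a curve, read off from its Fréchet derivative. -/
theorem hasDerivAt_fderiv_apply_comp {E : Type*} [NormedAddCommGroup E] [NormedSpace ℝ E]
    {F : E → ℝ} (hF : ContDiff ℝ 2 F) {c : ℝ → E} {c' : E} {r : ℝ}
    (hc : HasDerivAt c c' r) (v : E) :
    HasDerivAt (fun r => fderiv ℝ F (c r) v) (fderiv ℝ (fderiv ℝ F) (c r) c' v) r := by
  have hD : Differentiable ℝ (fderiv ℝ F) :=
    (hF.fderiv_right (m := 1) (by norm_num)).differentiable (by norm_num)
  simpa using ((hD (c r)).hasFDerivAt.comp_hasDerivAt r hc).clm_apply (hasDerivAt_const r v)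


/-- equation (62) of the paper: points carrying a fixed value `κ` of the
quasimomentum, i.e. a differentiable curve `x(t)` with `∂_κφ(x(t),t,κ) = x(t)` and
`∂_x∂_κφ(x(t),t,κ) ≠ 1`, move with the group velocity:
`x'(t) = s·Ω_ξ(t, κ − ∂_xφ(x(t),t,κ))`. -/
theorem stmt_11
    (Ω : ℝ → ℝ → ℝ) (hΩ : ContDiff ℝ 1 (fun p : ℝ × ℝ => Ω p.1 p.2))
    (s : ℝ) (hs : s = 1 ∨ s = -1)
    (φ : ℝ → ℝ → ℝ → ℝ)
    (hφ : ContDiff ℝ 2 (fun p : ℝ × ℝ × ℝ => φ p.1 p.2.1 p.2.2))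
    (heik : ∀ x t κ : ℝ, deriv (fun t' => φ x t' κ) t
      = s * Ω t (κ - deriv (fun x' => φ x' t κ) x))
    (κ : ℝ) (X : ℝ → ℝ) (hXdiff : Differentiable ℝ X)
    (hstat : ∀ t : ℝ, deriv (fun κ' => φ (X t) t κ') κ = X t)
    (hnd : ∀ t : ℝ,
      deriv (fun x' => deriv (fun κ' => φ x' t κ') κ) (X t) ≠ 1) :
    ∀ t : ℝ,
      deriv X t = s * deriv (fun ξ => Ω t ξ) (κ - deriv (fun x' => φ x' t κ) (X t)) := by
  intro t
  set F : ℝ × ℝ × ℝ → ℝ := fun p => φ p.1 p.2.1 p.2.2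
  have hF : Differentiable ℝ F := hφ.differentiable (by norm_num)
  have cx : ∀ x t κ : ℝ, HasDerivAt (fun y : ℝ => (y, t, κ)) ((1, 0, 0) : ℝ × ℝ × ℝ) x :=
    fun x t κ => (hasDerivAt_id x).prodMk (hasDerivAt_const x (t, κ))
  have ct : ∀ x t κ : ℝ, HasDerivAt (fun y : ℝ => (x, y, κ)) ((0, 1, 0) : ℝ × ℝ × ℝ) t :=
    fun x t κ => (hasDerivAt_const t x).prodMk ((hasDerivAt_id t).prodMk (hasDerivAt_const t κ))
  have cκ : ∀ x t κ : ℝ, HasDerivAt (fun y : ℝ => (x, t, y)) ((0, 0, 1) : ℝ × ℝ × ℝ) κ :=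
    fun x t κ => (hasDerivAt_const κ x).prodMk ((hasDerivAt_const κ t).prodMk (hasDerivAt_id κ))
  have dcomp : ∀ {c : ℝ → ℝ × ℝ × ℝ} {c' : ℝ × ℝ × ℝ} {r : ℝ}, HasDerivAt c c' r →
      deriv (fun y => F (c y)) r = fderiv ℝ F (c r) c' :=
    fun hc => ((hF _).hasFDerivAt.comp_hasDerivAt _ hc).deriv
  have dx : ∀ x t κ : ℝ, deriv (fun y => φ y t κ) x = fderiv ℝ F (x, t, κ) (1, 0, 0) :=
    fun x t κ => dcomp (cx x t κ)
  have dt : ∀ x t κ : ℝ, deriv (fun y => φ x y κ) t = fderiv ℝ F (x, t, κ) (0, 1, 0) :=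
    fun x t κ => dcomp (ct x t κ)
  have dκ : ∀ x t κ : ℝ, deriv (fun y => φ x t y) κ = fderiv ℝ F (x, t, κ) (0, 0, 1) :=
    fun x t κ => dcomp (cκ x t κ)
  simp only [dx, dt, dκ] at heik hstat hnd ⊢
  have hsymm : IsSymmSndFDerivAt ℝ F (X t, t, κ) :=
    hφ.contDiffAt.isSymmSndFDerivAt (by simp)
  have hΩd : DifferentiableAt ℝ (fun ξ => Ω t ξ) (κ - fderiv ℝ F (X t, t, κ) (1, 0, 0)) :=
    (hΩ.differentiable (by norm_num)).comp
      ((differentiable_const t).prodMk differentiable_id) _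
  have hmix := (hasDerivAt_fderiv_apply_comp hφ (cx (X t) t κ) (0, 0, 1)).deriv
  have hcurve := hasDerivAt_fderiv_apply_comp hφ
    ((hXdiff t).hasDerivAt.prodMk ((hasDerivAt_id t).prodMk (hasDerivAt_const t κ))) (0, 0, 1)
  have hX := hcurve.unique ((hXdiff t).hasDerivAt.congr_of_eventuallyEq
    (Filter.Eventually.of_forall hstat))
  have hleft := hasDerivAt_fderiv_apply_comp hφ (cκ (X t) t κ) (0, 1, 0)
  have hright := (hΩd.hasDerivAt.comp κ ((hasDerivAt_id κ).sub
    (hasDerivAt_fderiv_apply_comp hφ (cκ (X t) t κ) (1, 0, 0)))).const_mul s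
  have heikκ := hleft.unique (hright.congr_of_eventuallyEq
    (Filter.Eventually.of_forall fun κ' => heik (X t) t κ'))
  have hne := hnd t
  rw [hmix] at hne
  rw [hsymm.eq (0, 0, 1) (0, 1, 0), hsymm.eq (0, 0, 1) (1, 0, 0)] at heikκ
  have hvec : ((deriv X t, 1, 0) : ℝ × ℝ × ℝ)
      = deriv X t • ((1, 0, 0) : ℝ × ℝ × ℝ) + (0, 1, 0) := by simp
  simp only [id_eq] at hX
  rw [hvec, map_add, map_smul] at hX
  simp only [add_apply, smul_apply, smul_eq_mul] at hX
  refine mul_right_cancel₀ (sub_ne_zero.mpr hne.symm) ?_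
  linear_combination heikκ - hX
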